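/- Theorem (linearly factoring weights: rows are Pólya frequency sequences). Under the linear factorization hypothesis on the weights, if t ≥ 1 then for every n ∈ ℕ the Toeplitz matrix 𝒯(c) of the n-th row sequence c k = M n k of the weighted lattice-path matrix M is totally positive. -/

import Mathlib

open Finset

/-- A multivariate polynomial with real coefficients is *nonnegative* if all of
its coefficients are nonnegative. -/
def PolyNonneg {σ : Type*} (p : MvPolynomial σ ℝ) : Prop :=
  ∀ m, 0 ≤ p.coeff m

/-- An `ℕ × ℕ` matrix with entries in `MvPolynomial σ ℝ` is *totally positive*
if every minor (taken along strictly increasing row and column indices) is a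
nonnegative polynomial. -/
def TP {σ : Type*} (A : ℕ → ℕ → MvPolynomial σ ℝ) : Prop :=
  ∀ r : ℕ, 1 ≤ r → ∀ ρ κ : Fin r → ℕ, StrictMono ρ → StrictMono κ →
    PolyNonneg (Matrix.of fun i j : Fin r => A (ρ i) (κ j)).det

/-- The weighted lattice-path matrix `M`:
`M n 0 = ∏_{i=1}^n b i`, `M n k = 0` for `k ≥ 1` and `n < t`, and
`M n k = Σ_{i=0}^{ℓ} (a n i) * M (n-t-i) (k-1) + (b n) * M (n-1) k`
for `n ≥ t`, `k ≥ 1`, where summands with a negative first index vanish. -/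
def latticeM {R : Type*} [CommRing R] (t ℓ : ℕ) (a : ℕ → ℕ → R) (b : ℕ → R) :
    ℕ → ℕ → R
  | n, 0 => ∏ i ∈ Finset.Icc 1 n, b i
  | 0, k + 1 => if t = 0 then a 0 0 * latticeM t ℓ a b 0 k else 0
  | n + 1, k + 1 =>
      if n + 1 < t then 0
      else (∑ i ∈ Finset.range (ℓ + 1),
              if t + i ≤ n + 1 then a (n + 1) i * latticeM t ℓ a b (n + 1 - t - i) k
              else 0)
        + b (n + 1) * latticeM t ℓ a b n (k + 1)
  termination_by n k => (k, n)

/-- The Toeplitz matrix of a sequence: `𝒯(c) i j = c (i - j)` for `i ≥ j`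
and `0` otherwise. -/
def toeplitz {R : Type*} [CommRing R] (c : ℕ → R) : ℕ → ℕ → R :=
  fun i j => if j ≤ i then c (i - j) else 0

namespace PolyNonneg

variable {σ : Type*} {p q : MvPolynomial σ ℝ}

theorem zero : PolyNonneg (0 : MvPolynomial σ ℝ) := fun m => by simp

theorem one : PolyNonneg (1 : MvPolynomial σ ℝ) := fun m => by
  classical
  rw [MvPolynomial.coeff_one]
  split_ifs <;> norm_num

theorem add (hp : PolyNonneg p) (hq : PolyNonneg q) : PolyNonneg (p + q) := fun m => by
  rw [MvPolynomial.coeff_add]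
  exact add_nonneg (hp m) (hq m)

theorem mul (hp : PolyNonneg p) (hq : PolyNonneg q) : PolyNonneg (p * q) := fun m => by
  classical
  rw [MvPolynomial.coeff_mul]
  exact Finset.sum_nonneg fun x _ => mul_nonneg (hp _) (hq _)

theorem sum {ι : Type*} (s : Finset ι) (f : ι → MvPolynomial σ ℝ)
    (h : ∀ i ∈ s, PolyNonneg (f i)) : PolyNonneg (∑ i ∈ s, f i) :=
  Finset.sum_induction f PolyNonneg (fun _ _ => add) zero h

theorem prod {ι : Type*} (s : Finset ι) (f : ι → MvPolynomial σ ℝ)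
    (h : ∀ i ∈ s, PolyNonneg (f i)) : PolyNonneg (∏ i ∈ s, f i) :=
  Finset.prod_induction f PolyNonneg (fun _ _ => mul) one h

end PolyNonneg

namespace TP

variable {σ : Type*}

/-- Minors of a totally positive matrix along weakly increasing rows are nonnegative. -/
theorem polyNonneg_det_of_monotone {F : ℕ → ℕ → MvPolynomial σ ℝ} (hF : TP F) {r : ℕ}
    (hr : 1 ≤ r) {ρ κ : Fin r → ℕ} (hρ : Monotone ρ) (hκ : StrictMono κ) :
    PolyNonneg (Matrix.of fun i j : Fin r => F (ρ i) (κ j)).det := by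
  by_cases hinj : Function.Injective ρ
  · exact hF r hr ρ κ (hρ.strictMono_of_injective hinj) hκ
  · simp only [Function.Injective, not_forall] at hinj
    obtain ⟨i, j, hij, hne⟩ := hinj
    rw [Matrix.det_zero_of_row_eq hne (by ext x; simp [hij])]
    exact PolyNonneg.zero

/-- Total positivity is preserved when each row is replaced by a nonnegative combination of two
rows of the original matrix, provided the rows used are weakly increasing. -/
theorem of_two_rows {F G : ℕ → ℕ → MvPolynomial σ ℝ} (hF : TP F)
    (u v : ℕ → MvPolynomial σ ℝ) (hu : ∀ i, PolyNonneg (u i)) (hv : ∀ i, PolyNonneg (v i))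
    (φ ψ : ℕ → ℕ) (hψφ : ∀ i, ψ i ≤ φ i) (hφψ : ∀ i j, i < j → φ i ≤ ψ j)
    (hG : ∀ i j, G i j = u i * F (φ i) j + v i * F (ψ i) j) : TP G := by
  classical
  intro r hr ρ κ hρ hκ
  have hexp : (Matrix.of fun i j : Fin r => G (ρ i) (κ j)).det =
      ∑ S : Finset (Fin r), (∏ i, if i ∈ S then u (ρ i) else v (ρ i)) *
        (Matrix.of fun i j : Fin r =>
          F (if i ∈ S then φ (ρ i) else ψ (ρ i)) (κ j)).det := by
    have h1 : (Matrix.of fun i j : Fin r => G (ρ i) (κ j)) =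
        (fun i => u (ρ i) • fun j => F (φ (ρ i)) (κ j)) +
          (fun i => v (ρ i) • fun j => F (ψ (ρ i)) (κ j)) := by
      ext1 i j
      simp [hG]
    have h2 := (Matrix.detRowAlternating (n := Fin r)
      (R := MvPolynomial σ ℝ)).toMultilinearMap.map_add_univ
        (fun i => u (ρ i) • fun j => F (φ (ρ i)) (κ j))
        (fun i => v (ρ i) • fun j => F (ψ (ρ i)) (κ j))
    rw [h1]
    refine h2.trans (Finset.sum_congr rfl fun S _ => ?_)
    rw [← smul_eq_mul]
    refine Eq.trans ?_ ((Matrix.detRowAlternating (n := Fin r)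
      (R := MvPolynomial σ ℝ)).toMultilinearMap.map_smul_univ
        (fun i => if i ∈ S then u (ρ i) else v (ρ i))
        (fun i j => F (if i ∈ S then φ (ρ i) else ψ (ρ i)) (κ j)))
    congr 1
    ext1 i
    by_cases hi : i ∈ S <;> simp [Finset.piecewise, hi]
  rw [hexp]
  refine PolyNonneg.sum _ _ fun S _ => PolyNonneg.mul (PolyNonneg.prod _ _ fun i _ => ?_)
    (hF.polyNonneg_det_of_monotone hr ?_ hκ)
  · split_ifs
    exacts [hu _, hv _]
  · intro i j hij
    rcases hij.eq_or_lt with rfl | hlt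
    · exact le_rfl
    · have h1 := hφψ _ _ (hρ hlt)
      have h2 := hψφ (ρ i)
      have h3 := hψφ (ρ j)
      dsimp only
      split_ifs <;> omega

/-- Total positivity is preserved when the rows are selected by a weakly increasing map and
rescaled by nonnegative weights. -/
theorem of_monotone_rows {F G : ℕ → ℕ → MvPolynomial σ ℝ} (hF : TP F)
    (w : ℕ → MvPolynomial σ ℝ) (hw : ∀ i, PolyNonneg (w i)) (φ : ℕ → ℕ) (hφ : Monotone φ)
    (hG : ∀ i j, G i j = w i * F (φ i) j) : TP G :=
  hF.of_two_rows w 0 hw (fun _ => PolyNonneg.zero) φ φ (fun _ => le_rfl)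
    (fun _ _ h => hφ h.le) (by simp [hG])

theorem identity : TP fun i j : ℕ => if i = j then (1 : MvPolynomial σ ℝ) else 0 := by
  intro r _ ρ κ hρ hκ
  by_cases h : ∀ i, ρ i ∈ Set.range κ
  · have himg : Finset.univ.image ρ = Finset.univ.image κ := by
      refine Finset.eq_of_subset_of_card_le ?_ ?_
      · intro x hx
        obtain ⟨i, -, rfl⟩ := Finset.mem_image.1 hx
        obtain ⟨j, hj⟩ := h i
        exact Finset.mem_image.2 ⟨j, Finset.mem_univ _, hj⟩
      · rw [Finset.card_image_of_injective _ hρ.injective,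
          Finset.card_image_of_injective _ hκ.injective]
    have hρκ : ρ = κ := (hρ.range_inj hκ).1 <| by
      simpa using congrArg (fun s : Finset ℕ => (s : Set ℕ)) himg
    subst hρκ
    have : (Matrix.of fun i j : Fin r => if ρ i = ρ j then (1 : MvPolynomial σ ℝ) else 0) = 1 := by
      ext1 i j
      simp [Matrix.one_apply, hρ.injective.eq_iff]
    rw [this, Matrix.det_one]
    exact PolyNonneg.one
  · push Not at h
    obtain ⟨i, hi⟩ := h
    rw [Matrix.det_eq_zero_of_row_eq_zero i]
    · exact PolyNonneg.zero
    · intro j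
      have : ρ i ≠ κ j := fun h => hi ⟨j, h.symm⟩
      simp [this]

end TP

/-- The matrix obtained by interleaving the Toeplitz matrices of `g 0, …, g (N - 1)`: row
`N * k + s` is row `k` of the Toeplitz matrix of `g s`. -/
def interleavedToeplitz {R : Type*} [CommRing R] (N : ℕ) (g : ℕ → ℕ → R) : ℕ → ℕ → R :=
  fun r j => toeplitz (g (r % N)) (r / N) j

section interleaved

variable {σ : Type*} {N : ℕ} {g g' : ℕ → ℕ → MvPolynomial σ ℝ}

theorem Nat.sub_one_div_mod_of_mod_ne_zero {N r : ℕ} (h : r % N ≠ 0) :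
    (r - 1) / N = r / N ∧ (r - 1) % N = r % N - 1 := by
  rcases Nat.eq_zero_or_pos N with rfl | hN
  · simp
  · have h1 := Nat.div_add_mod r N
    have h2 := Nat.mod_lt r hN
    refine (Nat.div_mod_unique hN).2 ⟨?_, by omega⟩
    omega

theorem Nat.sub_one_div_mod_of_mod_eq_zero {N r : ℕ} (hN : 0 < N) (hr : 0 < r)
    (h : r % N = 0) : (r - 1) / N = r / N - 1 ∧ (r - 1) % N = N - 1 := by
  have h1 := Nat.div_add_mod r N
  obtain ⟨q, hq⟩ : ∃ q, r / N = q + 1 :=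
    Nat.exists_eq_succ_of_ne_zero fun h0 => by rw [h0, h] at h1; omega
  rw [hq] at h1 ⊢
  refine (Nat.div_mod_unique hN).2 ⟨?_, by omega⟩
  rw [Nat.mul_add] at h1
  simp only [Nat.add_sub_cancel]
  omega

/-- Shifting the components of an interleaved family up by one, keeping the zeroth one, and
rescaling by nonnegative weights preserves total positivity. -/
theorem TP.interleavedToeplitz_shift (h : TP (interleavedToeplitz N g))
    (w : ℕ → MvPolynomial σ ℝ) (hw : ∀ s, PolyNonneg (w s))
    (hg : ∀ s k, g' s k = w s * g (s - 1) k) : TP (interleavedToeplitz N g') := by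
  refine h.of_monotone_rows (fun r => w (r % N)) (fun r => hw _)
    (fun r => if r % N = 0 then r else r - 1) ?_ ?_
  · refine monotone_nat_of_le_succ fun r => ?_
    split_ifs <;> omega
  · intro r j
    unfold interleavedToeplitz toeplitz
    by_cases hr : r % N = 0
    · simp [hr, hg]
    · obtain ⟨h1, h2⟩ := Nat.sub_one_div_mod_of_mod_ne_zero hr
      simp [hr, hg, h1, h2]

/-- Adding to a component of an interleaved family a nonnegative multiple of the preceding one
preserves total positivity. -/
theorem TP.interleavedToeplitz_add_pred (h : TP (interleavedToeplitz N g)) (i : ℕ)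
    {c : MvPolynomial σ ℝ} (hc : PolyNonneg c)
    (hi : ∀ k, g' (i + 1) k = g (i + 1) k + c * g i k)
    (hg : ∀ s, s ≠ i + 1 → g' s = g s) : TP (interleavedToeplitz N g') := by
  refine h.of_two_rows 1 (fun r => if r % N = i + 1 then c else 0) (fun _ => PolyNonneg.one)
    (fun r => ?_) id (fun r => r - 1) (fun r => Nat.sub_le _ _) (fun r r' h => ?_) ?_
  · split_ifs
    exacts [hc, PolyNonneg.zero]
  · simp only [id]
    omega
  · intro r j
    unfold interleavedToeplitz toeplitz
    by_cases hr : r % N = i + 1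
    · obtain ⟨h1, h2⟩ := Nat.sub_one_div_mod_of_mod_ne_zero (N := N) (r := r) (by omega)
      simp only [hr, h1, h2, hi, id, Pi.one_apply, Nat.add_sub_cancel]
      split_ifs <;> simp
    · simp [hr, hg _ hr]

/-- Adding to the zeroth component of an interleaved family the shifted last component
preserves total positivity. -/
theorem TP.interleavedToeplitz_add_last {L : ℕ} (h : TP (interleavedToeplitz (L + 1) g))
    (h0 : g' 0 0 = g 0 0) (hk : ∀ k, g' 0 (k + 1) = g 0 (k + 1) + g L k)
    (hg : ∀ s, s ≠ 0 → s ≤ L → g' s = g s) : TP (interleavedToeplitz (L + 1) g') := by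
  refine h.of_two_rows 1 (fun r => if r % (L + 1) = 0 ∧ 0 < r then 1 else 0)
    (fun _ => PolyNonneg.one)
    (fun r => ?_) id (fun r => r - 1) (fun r => Nat.sub_le _ _) (fun r r' h => ?_) ?_
  · split_ifs
    exacts [PolyNonneg.one, PolyNonneg.zero]
  · simp only [id]
    omega
  · intro r j
    unfold interleavedToeplitz toeplitz
    by_cases hr : r % (L + 1) = 0
    · rcases Nat.eq_zero_or_pos r with rfl | hpos
      · rcases j with _ | j <;> simp [h0]
      · obtain ⟨h1, h2⟩ := Nat.sub_one_div_mod_of_mod_eq_zero (Nat.add_one_pos L) hpos hr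
        have hq : 0 < r / (L + 1) :=
          Nat.div_pos (Nat.le_of_dvd hpos (Nat.dvd_of_mod_eq_zero hr)) (Nat.add_one_pos L)
        simp only [hr, h1, h2, id, Pi.one_apply, hpos, and_self, if_true, one_mul,
          Nat.add_sub_cancel]
        obtain ⟨q, hq⟩ := Nat.exists_eq_succ_of_ne_zero hq.ne'
        rw [hq, Nat.succ_eq_add_one, Nat.add_sub_cancel]
        rcases lt_trichotomy j (q + 1) with hj | rfl | hj
        · rw [if_pos hj.le, if_pos hj.le, if_pos (by omega), Nat.sub_add_comm (by omega), hk]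
        · simp [h0]
        · rw [if_neg (by omega), if_neg (by omega), if_neg (by omega), add_zero]
    · have hlt := Nat.mod_lt r (Nat.add_one_pos L)
      simp [hr, hg _ hr (by omega)]

/-- A family of sequences obtained from `(1, 0, …, 0)` by planar transfer steps has totally
positive interleaved Toeplitz matrices. -/
theorem TP.interleavedToeplitz_of_recurrence {L : ℕ} (hL : 0 < L)
    (A B b : ℕ → MvPolynomial σ ℝ) (hA : ∀ i, PolyNonneg (A i)) (hB : ∀ i, PolyNonneg (B i))
    (hb : ∀ i, PolyNonneg (b i)) (hB0 : B 0 = 0) (S : ℕ → ℕ → ℕ → MvPolynomial σ ℝ)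
    (hstart : ∀ s k, S 0 s k = if s = 0 ∧ k = 0 then 1 else 0)
    (hsucc : ∀ m i k, S (m + 1) (i + 1) k = A i * S m i k + B i * S (m + 1) i k)
    (hzero : ∀ m, S (m + 1) 0 0 = b (m + 1) * S m 0 0)
    (hlast : ∀ m k, S (m + 1) 0 (k + 1) = b (m + 1) * S m 0 (k + 1) + S (m + 1) L k) (m : ℕ) :
    TP (interleavedToeplitz (L + 1) (S m)) := by
  induction m with
  | zero =>
    refine TP.identity.of_monotone_rows (fun r => if r % (L + 1) = 0 then 1 else 0)
      (fun r => ?_) (fun r => r / (L + 1)) (fun r r' h => Nat.div_le_div_right h) ?_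
    · split_ifs
      exacts [PolyNonneg.one, PolyNonneg.zero]
    · intro r j
      simp only [interleavedToeplitz, toeplitz, hstart]
      by_cases hr : r % (L + 1) = 0
      · simp only [hr, true_and, if_true, one_mul]
        split_ifs <;> first | rfl | omega
      · simp [hr]
  | succ m ih =>
    let T : ℕ → ℕ → ℕ → MvPolynomial σ ℝ := fun j s k =>
      if s = 0 then b (m + 1) * S m 0 k
      else if s ≤ j then S (m + 1) s k else A (s - 1) * S m (s - 1) k
    have hT : ∀ j, TP (interleavedToeplitz (L + 1) (T j)) := by
      intro j
      induction j with
      | zero =>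
        refine ih.interleavedToeplitz_shift
          (fun s => if s = 0 then b (m + 1) else A (s - 1)) (fun s => ?_) fun s k => ?_
        · split_ifs
          exacts [hb _, hA _]
        · rcases s with _ | s <;> simp [T]
      | succ j ihj =>
        refine ihj.interleavedToeplitz_add_pred j (hB j) (fun k => ?_) fun s hs => ?_
        · rcases j with _ | j
          · simp [T, hsucc, hB0]
          · simp [T, hsucc m (j + 1)]
        · ext1 k
          have : s ≤ j + 1 ↔ s ≤ j := by omega
          simp [T, this]
    refine (hT L).interleavedToeplitz_add_last ?_ (fun k => ?_) fun s hs hsL => ?_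
    · simp [T, hzero]
    · simp [T, hlast, hL.ne']
    · ext1 k
      simp [T, hs, hsL]

end interleaved

section latticeM

variable {R : Type*} [CommRing R]

theorem latticeM_eq_zero_of_lt {t : ℕ} (ℓ : ℕ) (a : ℕ → ℕ → R) (b : ℕ → R) {n : ℕ} (k : ℕ)
    (h : n < t) : latticeM t ℓ a b n (k + 1) = 0 := by
  rcases n with _ | n
  · rw [latticeM, if_neg (by omega)]
  · rw [latticeM, if_pos h]

/-- The generating function of a column of `latticeM`. -/
noncomputable def latticeColumnSeries (t ℓ : ℕ) (a : ℕ → ℕ → R) (b : ℕ → R) (k : ℕ) :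
    PowerSeries R :=
  PowerSeries.mk fun n => latticeM t ℓ a b n k

theorem latticeM_succ_succ {t : ℕ} (ℓ : ℕ) (a : ℕ → ℕ → R) (b : ℕ → R) (n k : ℕ) :
    latticeM t ℓ a b (n + 1) (k + 1) = b (n + 1) * latticeM t ℓ a b n (k + 1) +
      PowerSeries.coeff (n + 1) (PowerSeries.X ^ t *
        (∑ i ∈ Finset.range (ℓ + 1), PowerSeries.C (a (n + 1) i) * PowerSeries.X ^ i) *
          latticeColumnSeries t ℓ a b k) := by
  have hcoeff : PowerSeries.coeff (n + 1) (PowerSeries.X ^ t *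
        (∑ i ∈ Finset.range (ℓ + 1), PowerSeries.C (a (n + 1) i) * PowerSeries.X ^ i) *
          latticeColumnSeries t ℓ a b k) =
      ∑ i ∈ Finset.range (ℓ + 1), if t + i ≤ n + 1
        then a (n + 1) i * latticeM t ℓ a b (n + 1 - t - i) k else 0 := by
    rw [Finset.mul_sum, Finset.sum_mul, map_sum]
    refine Finset.sum_congr rfl fun i _ => ?_
    rw [show PowerSeries.X ^ t * (PowerSeries.C (a (n + 1) i) * PowerSeries.X ^ i) *
        latticeColumnSeries t ℓ a b k = PowerSeries.C (a (n + 1) i) *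
          (PowerSeries.X ^ (t + i) * latticeColumnSeries t ℓ a b k) by ring,
      PowerSeries.coeff_C_mul, PowerSeries.coeff_X_pow_mul', mul_ite, mul_zero,
      latticeColumnSeries, PowerSeries.coeff_mk, Nat.sub_sub]
  rw [hcoeff, latticeM]
  split_ifs with h
  · rw [latticeM_eq_zero_of_lt ℓ a b k (by omega : n < t), mul_zero, zero_add, eq_comm]
    exact Finset.sum_eq_zero fun i _ => if_neg (by omega)
  · rw [add_comm]

theorem prod_C_mul_X_add_C_eq_sum {ℓ : ℕ} (α β : Fin ℓ → R) :
    ∏ j, (PowerSeries.C (α j) * PowerSeries.X + PowerSeries.C (β j)) =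
      ∑ i ∈ Finset.range (ℓ + 1), PowerSeries.C
        (∑ S ∈ Finset.powersetCard i (Finset.univ : Finset (Fin ℓ)),
          (∏ j ∈ S, α j) * ∏ j ∈ Sᶜ, β j) * PowerSeries.X ^ i := by
  rw [Finset.prod_add, Finset.sum_powerset, Finset.card_univ, Fintype.card_fin]
  refine Finset.sum_congr rfl fun i _ => ?_
  rw [map_sum, Finset.sum_mul]
  refine Finset.sum_congr rfl fun S hS => ?_
  rw [Finset.prod_mul_distrib, Finset.prod_const, (Finset.mem_powersetCard.1 hS).2,
    ← Finset.compl_eq_univ_sdiff, map_mul, map_prod, map_prod]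
  ring

end latticeM

/-- **Theorem (linearly factoring weights: rows are Pólya frequency
sequences).**  Under the linear factorization hypothesis on the weights, if
`t ≥ 1` then for every `n` the Toeplitz matrix of the `n`-th row sequence
`k ↦ M n k` of the weighted lattice-path matrix `M` is totally positive. -/
theorem toeplitz_row_latticeM_totallyPositive_of_linear_factorization
    {σ : Type*} (t ℓ : ℕ) (ht : 1 ≤ t)
    (a : ℕ → ℕ → MvPolynomial σ ℝ) (b : ℕ → MvPolynomial σ ℝ)
    (hb : ∀ n, PolyNonneg (b n))
    (α β : Fin ℓ → MvPolynomial σ ℝ)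
    (hα : ∀ j, PolyNonneg (α j)) (hβ : ∀ j, PolyNonneg (β j))
    (hfact : ∀ n i, i ≤ ℓ → a n i =
      ∑ S ∈ Finset.powersetCard i (Finset.univ : Finset (Fin ℓ)),
        (∏ j ∈ S, α j) * ∏ j ∈ Sᶜ, β j)
    (n : ℕ) :
    TP (toeplitz fun k => latticeM t ℓ a b n k) := by
  let A : ℕ → MvPolynomial σ ℝ := fun i => if h : i - t < ℓ ∧ t ≤ i then α ⟨i - t, h.1⟩ else 1
  let B : ℕ → MvPolynomial σ ℝ := fun i => if h : i - t < ℓ ∧ t ≤ i then β ⟨i - t, h.1⟩ else 0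
  let W : ℕ → PowerSeries (MvPolynomial σ ℝ) := fun s =>
    ∏ i ∈ Finset.range s, (PowerSeries.C (A i) * PowerSeries.X + PowerSeries.C (B i))
  let S : ℕ → ℕ → ℕ → MvPolynomial σ ℝ := fun m s k =>
    PowerSeries.coeff m (W s * latticeColumnSeries t ℓ a b k)
  have hB0 : B 0 = 0 := dif_neg (by omega)
  have hS0 : ∀ m k, S m 0 k = latticeM t ℓ a b m k := fun m k => by
    simp [S, W, latticeColumnSeries]
  have hW : ∀ m, W (t + ℓ) = PowerSeries.X ^ t *
      ∑ i ∈ Finset.range (ℓ + 1), PowerSeries.C (a m i) * PowerSeries.X ^ i := by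
    intro m
    have h1 : ∀ i ∈ Finset.range t,
        PowerSeries.C (A i) * PowerSeries.X + PowerSeries.C (B i) = PowerSeries.X := by
      intro i hi
      have hi' : ¬ t ≤ i := not_le.2 (Finset.mem_range.1 hi)
      simp [A, B, hi']
    have h2 : ∀ i ∈ Finset.range (ℓ + 1), PowerSeries.C (a m i) * PowerSeries.X ^ i =
        PowerSeries.C (∑ S ∈ Finset.powersetCard i (Finset.univ : Finset (Fin ℓ)),
          (∏ j ∈ S, α j) * ∏ j ∈ Sᶜ, β j) * PowerSeries.X ^ i := fun i hi => by
      rw [hfact m i (Nat.lt_succ_iff.1 (Finset.mem_range.1 hi))]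
    simp only [W]
    rw [Finset.prod_range_add, Finset.prod_congr rfl h1, Finset.prod_const, Finset.card_range,
      Finset.sum_congr rfl h2, ← prod_C_mul_X_add_C_eq_sum, Finset.prod_range]
    simp [A, B]
  have hTP : TP (interleavedToeplitz (t + ℓ + 1) (S n)) := by
    refine TP.interleavedToeplitz_of_recurrence (by omega) A B b (fun i => ?_) (fun i => ?_) hb hB0 S
      ?_ ?_ ?_ ?_ n
    · simp only [A]
      split_ifs
      exacts [hα _, PolyNonneg.one]
    · simp only [B]
      split_ifs
      exacts [hβ _, PolyNonneg.zero]
    · intro s k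
      rcases s with _ | s
      · rw [hS0]
        rcases k with _ | k
        · simp [latticeM]
        · simp [latticeM_eq_zero_of_lt ℓ a b k ht]
      · simp [S, W, Finset.prod_range_succ', hB0]
    · intro m i k
      have : W (i + 1) * latticeColumnSeries t ℓ a b k =
          PowerSeries.C (A i) * (PowerSeries.X * (W i * latticeColumnSeries t ℓ a b k)) +
            PowerSeries.C (B i) * (W i * latticeColumnSeries t ℓ a b k) := by
        simp only [W, Finset.prod_range_succ]
        ring
      simp only [S]
      rw [this, map_add, PowerSeries.coeff_C_mul, PowerSeries.coeff_C_mul,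
        PowerSeries.coeff_succ_X_mul]
    · intro m
      rw [hS0, hS0, latticeM, latticeM, Finset.prod_Icc_succ_top (by omega), mul_comm]
    · intro m k
      rw [hS0, hS0, latticeM_succ_succ, ← hW]
  refine hTP.of_monotone_rows 1 (fun _ => PolyNonneg.one) (fun r => (t + ℓ + 1) * r)
    (fun r r' h => Nat.mul_le_mul_left _ h) fun r j => ?_
  simp [interleavedToeplitz, toeplitz, hS0]
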